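/- Let C₁ and C₂ be Cantor sets, Y = C₁ * C₂ their topological join, and ΣY the suspension of Y with suspension points n and p. Suppose Z is a subspace of ΣY and h : ΣZ → ΣY is a homeomorphism whose restriction to Z (identified with the image of Z × {1/2} in ΣZ) is the inclusion of Z into ΣY. Then h maps the two suspension points of ΣZ onto the set {n, p}. -/

import Mathlib

open Set Filter Topology

universe u

/-- The equivalence generating the unreduced suspension: collapse `W × {0}` to a point `n`
and `W × {1}` to a point `p`. -/
def suspRel (W : Type u) : W × unitInterval → W × unitInterval → Prop := fun a b =>
  a = b ∨ (a.2 = 0 ∧ b.2 = 0) ∨ (a.2 = 1 ∧ b.2 = 1)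

/-- The unreduced suspension `ΣW` of `W`, as a quotient of `W × [0,1]`. -/
def Susp (W : Type u) : Type u := Quot (suspRel W)

instance (W : Type u) [TopologicalSpace W] : TopologicalSpace (Susp W) :=
  inferInstanceAs (TopologicalSpace (Quot (suspRel W)))

/-- The image of `(w, t)` in the suspension. -/
def suspMk (W : Type u) [TopologicalSpace W] (w : W) (t : unitInterval) : Susp W :=
  Quot.mk _ (w, t)

/-- The set `{n, p}` of the two suspension points of `ΣW` (for `W` nonempty),
i.e. the image of `W × {0, 1}`. -/
def suspPoles (W : Type u) [TopologicalSpace W] : Set (Susp W) :=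
  {z | ∃ w t, z = suspMk W w t ∧ (t = 0 ∨ t = 1)}

/-- The suspension arc of `ΣW` through `w ∈ W`: the image of `{w} × [0,1]`. -/
def suspArc (W : Type u) [TopologicalSpace W] (w : W) : Set (Susp W) :=
  {z | ∃ t, z = suspMk W w t}

/-- The equivalence generating the topological join: identify `(a,b,0) ~ (a,b',0)` and
`(a,b,1) ~ (a',b,1)`. -/
def joinRel (C₁ C₂ : Type u) : C₁ × C₂ × unitInterval → C₁ × C₂ × unitInterval → Prop :=
  fun x y =>
    x = y ∨ (x.2.2 = 0 ∧ y.2.2 = 0 ∧ x.1 = y.1) ∨ (x.2.2 = 1 ∧ y.2.2 = 1 ∧ x.2.1 = y.2.1)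

/-- The topological join `C₁ * C₂`, as a quotient of `C₁ × C₂ × [0,1]`. -/
def TopJoin (C₁ C₂ : Type u) : Type u := Quot (joinRel C₁ C₂)

instance (C₁ C₂ : Type u) [TopologicalSpace C₁] [TopologicalSpace C₂] :
    TopologicalSpace (TopJoin C₁ C₂) :=
  inferInstanceAs (TopologicalSpace (Quot (joinRel C₁ C₂)))

/-- The image of `(a, b, t)` in the join. -/
def joinMk (C₁ C₂ : Type u) [TopologicalSpace C₁] [TopologicalSpace C₂]
    (a : C₁) (b : C₂) (t : unitInterval) : TopJoin C₁ C₂ := Quot.mk _ (a, b, t)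

/-- The copy of `C₁` inside `C₁ * C₂`: the image of `C₁ × C₂ × {0}`. -/
def joinC1 (C₁ C₂ : Type u) [TopologicalSpace C₁] [TopologicalSpace C₂] :
    Set (TopJoin C₁ C₂) := {y | ∃ a b, y = joinMk C₁ C₂ a b 0}

/-- The copy of `C₂` inside `C₁ * C₂`: the image of `C₁ × C₂ × {1}`. -/
def joinC2 (C₁ C₂ : Type u) [TopologicalSpace C₁] [TopologicalSpace C₂] :
    Set (TopJoin C₁ C₂) := {y | ∃ a b, y = joinMk C₁ C₂ a b 1}

/-- The join arc from `a ∈ C₁` to `b ∈ C₂`: the image of `{(a,b)} × [0,1]`. -/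
def joinArc (C₁ C₂ : Type u) [TopologicalSpace C₁] [TopologicalSpace C₂]
    (a : C₁) (b : C₂) : Set (TopJoin C₁ C₂) := {y | ∃ t, y = joinMk C₁ C₂ a b t}

/-- A space is connected im kleinen at `x`: `x` has a neighbourhood basis of preconnected sets. -/
def LocallyPreconnectedAt {X : Type*} [TopologicalSpace X] (x : X) : Prop :=
  ∀ U ∈ 𝓝 x, ∃ V ∈ 𝓝 x, V ⊆ U ∧ IsPreconnected V

theorem LocallyPreconnectedAt.map_homeomorph {X Y : Type*} [TopologicalSpace X]
    [TopologicalSpace Y] {x : X} (hx : LocallyPreconnectedAt x) (e : X ≃ₜ Y) :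
    LocallyPreconnectedAt (e x) := by
  intro U hU
  obtain ⟨V, hV, hVU, hVc⟩ := hx (e ⁻¹' U) (e.continuous.continuousAt hU)
  refine ⟨e '' V, ?_, image_subset_iff.2 hVU, hVc.image e e.continuous.continuousOn⟩
  rw [← e.map_nhds_eq]
  exact image_mem_map hV

section Suspension

variable {W : Type u} [TopologicalSpace W]

theorem continuous_suspMk : Continuous fun q : W × unitInterval => suspMk W q.1 q.2 :=
  continuous_quot_mk

theorem exists_suspMk_eq (x : Susp W) : ∃ w t, x = suspMk W w t := by
  obtain ⟨⟨w, t⟩, rfl⟩ := Quot.exists_rep x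
  exact ⟨w, t, rfl⟩

theorem isOpen_susp_iff {U : Set (Susp W)} :
    IsOpen U ↔ IsOpen {q : W × unitInterval | suspMk W q.1 q.2 ∈ U} :=
  isOpen_coinduced

/-- The height coordinate of a suspension. -/
def suspHeight (W : Type u) [TopologicalSpace W] : Susp W → unitInterval :=
  Quot.lift Prod.snd (by
    rintro a b (h | ⟨h, h'⟩ | ⟨h, h'⟩)
    · rw [h]
    · rw [h, h']
    · rw [h, h'])

theorem continuous_suspHeight : Continuous (suspHeight W) :=
  continuous_quot_lift _ continuous_snd

theorem suspMk_zero_eq (w w' : W) : suspMk W w 0 = suspMk W w' 0 :=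
  Quot.sound (Or.inr (Or.inl ⟨rfl, rfl⟩))

theorem suspMk_one_eq (w w' : W) : suspMk W w 1 = suspMk W w' 1 :=
  Quot.sound (Or.inr (Or.inr ⟨rfl, rfl⟩))

theorem suspHeight_of_mem_suspPoles {x : Susp W} (hx : x ∈ suspPoles W) :
    suspHeight W x = 0 ∨ suspHeight W x = 1 := by
  obtain ⟨w, t, rfl, ht⟩ := hx
  exact ht

theorem eq_of_mem_suspPoles {x y : Susp W} (hx : x ∈ suspPoles W) (hy : y ∈ suspPoles W)
    (hxy : suspHeight W x = suspHeight W y) : x = y := by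
  obtain ⟨w, t, rfl, ht⟩ := hx
  obtain ⟨w', t', rfl, -⟩ := hy
  obtain rfl : t = t' := hxy
  rcases ht with rfl | rfl
  · exact suspMk_zero_eq _ _
  · exact suspMk_one_eq _ _

/-- The self-map of a suspension induced by a self-map of the interval fixing the endpoints. -/
def suspReparam (W : Type u) [TopologicalSpace W] (φ : unitInterval → unitInterval)
    (h0 : φ 0 = 0) (h1 : φ 1 = 1) : Susp W → Susp W :=
  Quot.lift (fun q => suspMk W q.1 (φ q.2)) (by
    rintro ⟨w, t⟩ ⟨w', t'⟩ (h | ⟨h, h'⟩ | ⟨h, h'⟩)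
    · rw [h]
    · dsimp only at h h' ⊢
      rw [h, h', h0, suspMk_zero_eq]
    · dsimp only at h h' ⊢
      rw [h, h', h1, suspMk_one_eq])

theorem continuous_suspReparam {φ : unitInterval → unitInterval} (h0 : φ 0 = 0) (h1 : φ 1 = 1)
    (hφ : Continuous φ) : Continuous (suspReparam W φ h0 h1) :=
  continuous_quot_lift _
    (continuous_suspMk.comp (continuous_fst.prodMk (hφ.comp continuous_snd)))

/-- The self-homeomorphism of a suspension induced by a self-homeomorphism of the interval fixing
the endpoints. -/
def suspHomeomorph (W : Type u) [TopologicalSpace W] (φ : unitInterval ≃ₜ unitInterval)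
    (h0 : φ 0 = 0) (h1 : φ 1 = 1) : Susp W ≃ₜ Susp W where
  toFun := suspReparam W φ h0 h1
  invFun := suspReparam W φ.symm (φ.symm_apply_eq.2 h0.symm) (φ.symm_apply_eq.2 h1.symm)
  left_inv x := by
    obtain ⟨w, t, rfl⟩ := exists_suspMk_eq x
    exact congrArg (suspMk W w) (φ.symm_apply_apply t)
  right_inv x := by
    obtain ⟨w, t, rfl⟩ := exists_suspMk_eq x
    exact congrArg (suspMk W w) (φ.apply_symm_apply t)
  continuous_toFun := continuous_suspReparam h0 h1 φ.continuous
  continuous_invFun := continuous_suspReparam _ _ φ.symm.continuous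

/-- Squaring, as a self-homeomorphism of the unit interval. -/
noncomputable def unitIntervalSq : unitInterval ≃ₜ unitInterval where
  toFun t := t * t
  invFun t := ⟨√t, Real.sqrt_nonneg _, Real.sqrt_le_one.2 t.2.2⟩
  left_inv t := Subtype.ext (Real.sqrt_mul_self t.2.1)
  right_inv t := Subtype.ext (Real.mul_self_sqrt t.2.1)
  continuous_toFun := by fun_prop
  continuous_invFun := by fun_prop

theorem unitIntervalSq_lt {t : unitInterval} (h0 : 0 < t) (h1 : t < 1) :
    0 < unitIntervalSq t ∧ unitIntervalSq t < t := by
  have h0' : (0 : ℝ) < t := h0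
  have h1' : (t : ℝ) < 1 := h1
  refine ⟨?_, ?_⟩
  · change (0 : ℝ) < t * t
    positivity
  · change (t * t : ℝ) < t
    nlinarith

theorem LocallyPreconnectedAt.suspMk_sq {w : W} {t : unitInterval}
    (h : LocallyPreconnectedAt (suspMk W w t)) :
    LocallyPreconnectedAt (suspMk W w (unitIntervalSq t)) :=
  h.map_homeomorph (suspHomeomorph W unitIntervalSq (mul_zero _) (mul_one _))

/-- If all points at which a space is locally preconnected lie among the poles of a suspension
structure, they lie among the poles of every suspension structure. -/
theorem mem_suspPoles_of_locallyPreconnectedAt {V : Type u} [TopologicalSpace V]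
    (hV : ∀ y : Susp V, LocallyPreconnectedAt y → y ∈ suspPoles V)
    (h : Susp W ≃ₜ Susp V) {x : Susp W} (hx : LocallyPreconnectedAt x) : x ∈ suspPoles W := by
  obtain ⟨w, t, rfl⟩ := exists_suspMk_eq x
  by_contra hpole
  have ht0 : 0 < t := unitInterval.pos_iff_ne_zero.2 fun ht => hpole ⟨w, t, rfl, Or.inl ht⟩
  have ht1 : t < 1 := unitInterval.lt_one_iff_ne_one.2 fun ht => hpole ⟨w, t, rfl, Or.inr ht⟩
  obtain ⟨hs0, hst⟩ := unitIntervalSq_lt ht0 ht1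
  obtain ⟨-, hrs⟩ := unitIntervalSq_lt hs0 (hst.trans ht1)
  have key : ∀ {r s : unitInterval}, LocallyPreconnectedAt (suspMk W w r) →
      LocallyPreconnectedAt (suspMk W w s) → s < r →
      suspHeight V (h (suspMk W w r)) ≠ suspHeight V (h (suspMk W w s)) := by
    intro r s hr hs hsr heq
    have := h.injective (eq_of_mem_suspPoles (hV _ (hr.map_homeomorph h))
      (hV _ (hs.map_homeomorph h)) heq)
    exact hsr.ne' (congrArg (suspHeight W) this)
  have k₁ := key hx hx.suspMk_sq hst
  have k₂ := key hx.suspMk_sq hx.suspMk_sq.suspMk_sq hrs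
  have k₃ := key hx hx.suspMk_sq.suspMk_sq (hrs.trans hst)
  rcases suspHeight_of_mem_suspPoles (hV _ (hx.map_homeomorph h)) with a | a <;>
  rcases suspHeight_of_mem_suspPoles (hV _ (hx.suspMk_sq.map_homeomorph h)) with b | b <;>
  rcases suspHeight_of_mem_suspPoles (hV _ (hx.suspMk_sq.suspMk_sq.map_homeomorph h)) with c | c <;>
  simp_all

/-- The tube lemma for the endpoints: a neighbourhood of a pole contains a cone around it. -/
theorem exists_nhds_height_subset [CompactSpace W] {w : W} {t : unitInterval}
    (ht : ∀ w', suspMk W w' t = suspMk W w t) {U : Set (Susp W)} (hU : U ∈ 𝓝 (suspMk W w t)) :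
    ∃ I ∈ 𝓝 t, ∀ w' : W, ∀ s ∈ I, suspMk W w' s ∈ U := by
  have : ∀ᶠ s in 𝓝 t, ∀ w' ∈ (univ : Set W), suspMk W w' s ∈ U := by
    refine isCompact_univ.eventually_forall_of_forall_eventually fun w' _ => ?_
    have hc : ContinuousAt (fun q : unitInterval × W => suspMk W q.2 q.1) (t, w') :=
      (continuous_suspMk.comp continuous_swap).continuousAt
    exact hc (show U ∈ 𝓝 (suspMk W w' t) from (ht w').symm ▸ hU)
  exact ⟨_, this, fun w' s hs => hs w' (mem_univ _)⟩

theorem locallyPreconnectedAt_pole [CompactSpace W] {w : W} {t : unitInterval}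
    (ht : ∀ w', suspMk W w' t = suspMk W w t) : LocallyPreconnectedAt (suspMk W w t) := by
  intro U hU
  obtain ⟨I, hI, hIU⟩ := exists_nhds_height_subset ht hU
  obtain ⟨ε, hε, hJI⟩ := Metric.mem_nhds_iff.1 hI
  set J := Metric.ball t ε
  have hJ : J ∈ 𝓝 t := Metric.ball_mem_nhds t hε
  have hJc : IsPreconnected J := by
    have : J = Subtype.val ⁻¹' Metric.ball (t : ℝ) ε := rfl
    rw [this, Real.ball_eq_Ioo]
    exact (ordConnected_Ioo.preimage_mono (Subtype.mono_coe _)).isPreconnected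
  refine ⟨suspHeight W ⁻¹' J, continuous_suspHeight.continuousAt hJ, ?_, ?_⟩
  · intro x hx
    obtain ⟨w', s, rfl⟩ := exists_suspMk_eq x
    exact hIU w' s (hJI hx)
  · refine isPreconnected_of_forall (suspMk W w t) fun x hx => ?_
    obtain ⟨w', s, rfl⟩ := exists_suspMk_eq x
    refine ⟨suspMk W w' '' J, image_subset_iff.2 fun r hr => hr,
      ⟨t, mem_of_mem_nhds hJ, ht w'⟩, mem_image_of_mem _ hx, ?_⟩
    exact hJc.image _ (continuous_suspMk.comp (Continuous.prodMk_right w')).continuousOn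

theorem locallyPreconnectedAt_of_mem_suspPoles [CompactSpace W] {x : Susp W}
    (hx : x ∈ suspPoles W) : LocallyPreconnectedAt x := by
  obtain ⟨w, t, rfl, rfl | rfl⟩ := hx
  · exact locallyPreconnectedAt_pole fun w' => suspMk_zero_eq w' w
  · exact locallyPreconnectedAt_pole fun w' => suspMk_one_eq w' w

/-- The open cylinder over `A` in a suspension: the image of `A × (0,1)`. -/
def suspCyl (A : Set W) : Set (Susp W) :=
  Quot.lift (fun q => q.1 ∈ A ∧ q.2 ≠ 0 ∧ q.2 ≠ 1) (by
    rintro ⟨w, t⟩ ⟨w', t'⟩ (h | ⟨h, h'⟩ | ⟨h, h'⟩)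
    · rw [h]
    · simp_all
    · simp_all)

theorem isOpen_suspCyl {A : Set W} (hA : IsOpen A) : IsOpen (suspCyl A) := by
  rw [isOpen_susp_iff]
  exact (hA.preimage continuous_fst).inter
    ((isOpen_ne.preimage continuous_snd).inter (isOpen_ne.preimage continuous_snd))

/-- If `w` has an open neighbourhood `G` such that every neighbourhood of `w` meets both parts of
some partition of `G` into open sets, then the suspension is not locally preconnected at the
non-pole points over `w`. -/
theorem not_locallyPreconnectedAt_suspMk {w : W} {G : Set W} (hG : IsOpen G) (hwG : w ∈ G)
    (hsep : ∀ N ∈ 𝓝 w, ∃ A B : Set W, IsOpen A ∧ IsOpen B ∧ Disjoint A B ∧ G ⊆ A ∪ B ∧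
      (N ∩ A).Nonempty ∧ (N ∩ B).Nonempty)
    {t : unitInterval} (h0 : t ≠ 0) (h1 : t ≠ 1) : ¬ LocallyPreconnectedAt (suspMk W w t) := by
  intro hP
  obtain ⟨V, hV, hVG, hVc⟩ := hP (suspCyl G) ((isOpen_suspCyl hG).mem_nhds ⟨hwG, h0, h1⟩)
  have hc : Continuous fun v : W => suspMk W v t :=
    continuous_suspMk.comp (Continuous.prodMk_left t)
  obtain ⟨A, B, hA, hB, hAB, hGAB, ⟨a, haV, haA⟩, ⟨b, hbV, hbB⟩⟩ :=
    hsep _ (hc.continuousAt hV)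
  obtain ⟨x, -, hxA, hxB⟩ := hVc _ _ (isOpen_suspCyl hA) (isOpen_suspCyl hB)
    (fun x hx => by
      obtain ⟨v, s, rfl⟩ := exists_suspMk_eq x
      obtain ⟨hv, hs⟩ := hVG hx
      exact (hGAB hv).imp (fun h => ⟨h, hs⟩) (fun h => ⟨h, hs⟩))
    ⟨_, haV, haA, h0, h1⟩ ⟨_, hbV, hbB, h0, h1⟩
  obtain ⟨v, s, rfl⟩ := exists_suspMk_eq x
  exact hAB.le_bot ⟨hxA.1, hxB.1⟩

end Suspension

theorem exists_isClopen_separating_nhds {C : Type*} [TopologicalSpace C] (e : C ≃ₜ (ℕ → Bool))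
    {a : C} {N : Set C} (hN : N ∈ 𝓝 a) :
    ∃ D : Set C, IsClopen D ∧ (N ∩ D).Nonempty ∧ (N ∩ Dᶜ).Nonempty := by
  have hlim : Tendsto (fun n => Function.update (e a) n (!e a n)) atTop (𝓝 (e a)) := by
    refine tendsto_pi_nhds.2 fun k => tendsto_nhds_of_eventually_eq ?_
    filter_upwards [eventually_gt_atTop k] with n hn
    exact Function.update_of_ne hn.ne _ _
  have hlim' := (e.symm.continuous.tendsto (e a)).comp hlim
  rw [e.symm_apply_apply] at hlim'
  obtain ⟨n, hn⟩ := (hlim'.eventually hN).exists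
  refine ⟨{c | e c n = e a n}, ?_, ⟨a, mem_of_mem_nhds hN, rfl⟩, ⟨_, hn, by simp⟩⟩
  exact (isClopen_discrete {e a n}).preimage ((continuous_apply n).comp e.continuous)

section Join

variable {C₁ C₂ : Type u} [TopologicalSpace C₁] [TopologicalSpace C₂]

theorem continuous_joinMk :
    Continuous fun q : C₁ × C₂ × unitInterval => joinMk C₁ C₂ q.1 q.2.1 q.2.2 :=
  continuous_quot_mk

theorem exists_joinMk_eq (y : TopJoin C₁ C₂) : ∃ a b t, y = joinMk C₁ C₂ a b t := by
  obtain ⟨⟨a, b, t⟩, rfl⟩ := Quot.exists_rep y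
  exact ⟨a, b, t, rfl⟩

theorem isOpen_join_iff {U : Set (TopJoin C₁ C₂)} :
    IsOpen U ↔ IsOpen {q : C₁ × C₂ × unitInterval | joinMk C₁ C₂ q.1 q.2.1 q.2.2 ∈ U} :=
  isOpen_coinduced

/-- The points of `C₁ * C₂` outside `C₂` whose first coordinate lies in `D`. -/
def joinLeft (C₂ : Type u) (D : Set C₁) : Set (TopJoin C₁ C₂) :=
  Quot.lift (fun q => q.1 ∈ D ∧ q.2.2 ≠ 1) (by
    rintro ⟨a, b, t⟩ ⟨a', b', t'⟩ (h | ⟨h, h', h''⟩ | ⟨h, h', h''⟩)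
    · rw [h]
    · simp_all
    · simp_all)

/-- The points of `C₁ * C₂` outside `C₁` whose second coordinate lies in `D`. -/
def joinRight (C₁ : Type u) (D : Set C₂) : Set (TopJoin C₁ C₂) :=
  Quot.lift (fun q => q.2.1 ∈ D ∧ q.2.2 ≠ 0) (by
    rintro ⟨a, b, t⟩ ⟨a', b', t'⟩ (h | ⟨h, h', h''⟩ | ⟨h, h', h''⟩)
    · rw [h]
    · simp_all
    · simp_all)

theorem isOpen_joinLeft {D : Set C₁} (hD : IsOpen D) : IsOpen (joinLeft C₂ D) := by
  rw [isOpen_join_iff]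
  exact (hD.preimage continuous_fst).inter (isOpen_ne.preimage (continuous_snd.comp continuous_snd))

theorem isOpen_joinRight {D : Set C₂} (hD : IsOpen D) : IsOpen (joinRight C₁ D) := by
  rw [isOpen_join_iff]
  exact (hD.preimage (continuous_fst.comp continuous_snd)).inter
    (isOpen_ne.preimage (continuous_snd.comp continuous_snd))

theorem not_locallyPreconnectedAt_of_ne_one (e₁ : C₁ ≃ₜ (ℕ → Bool)) {a : C₁} {b : C₂}
    {s t : unitInterval} (hs : s ≠ 1) (h0 : t ≠ 0) (h1 : t ≠ 1) :
    ¬ LocallyPreconnectedAt (suspMk _ (joinMk C₁ C₂ a b s) t) := by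
  refine not_locallyPreconnectedAt_suspMk (isOpen_joinLeft isOpen_univ)
    (show _ ∧ _ from ⟨mem_univ _, hs⟩) (fun N hN => ?_) h0 h1
  have hc : Continuous fun c : C₁ => joinMk C₁ C₂ c b s :=
    continuous_joinMk.comp (Continuous.prodMk_left (b, s))
  obtain ⟨D, hD, ⟨c, hcN, hcD⟩, ⟨d, hdN, hdD⟩⟩ :=
    exists_isClopen_separating_nhds e₁ (hc.continuousAt hN)
  refine ⟨joinLeft C₂ D, joinLeft C₂ Dᶜ, isOpen_joinLeft hD.isOpen, isOpen_joinLeft hD.compl.isOpen,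
    disjoint_left.2 fun y hy hy' => ?_, fun y hy => ?_, ⟨_, hcN, hcD, hs⟩, ⟨_, hdN, hdD, hs⟩⟩
  · obtain ⟨a', b', s', rfl⟩ := exists_joinMk_eq y
    exact hy'.1 hy.1
  · obtain ⟨a', b', s', rfl⟩ := exists_joinMk_eq y
    exact (em (a' ∈ D)).imp (fun h => ⟨h, hy.2⟩) (fun h => ⟨h, hy.2⟩)

theorem not_locallyPreconnectedAt_of_ne_zero (e₂ : C₂ ≃ₜ (ℕ → Bool)) {a : C₁} {b : C₂}
    {s t : unitInterval} (hs : s ≠ 0) (h0 : t ≠ 0) (h1 : t ≠ 1) :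
    ¬ LocallyPreconnectedAt (suspMk _ (joinMk C₁ C₂ a b s) t) := by
  refine not_locallyPreconnectedAt_suspMk (isOpen_joinRight isOpen_univ)
    (show _ ∧ _ from ⟨mem_univ _, hs⟩) (fun N hN => ?_) h0 h1
  have hc : Continuous fun c : C₂ => joinMk C₁ C₂ a c s :=
    continuous_joinMk.comp (continuous_const.prodMk (Continuous.prodMk_left s))
  obtain ⟨D, hD, ⟨c, hcN, hcD⟩, ⟨d, hdN, hdD⟩⟩ :=
    exists_isClopen_separating_nhds e₂ (hc.continuousAt hN)
  refine ⟨joinRight C₁ D, joinRight C₁ Dᶜ, isOpen_joinRight hD.isOpen,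
    isOpen_joinRight hD.compl.isOpen,
    disjoint_left.2 fun y hy hy' => ?_, fun y hy => ?_, ⟨_, hcN, hcD, hs⟩, ⟨_, hdN, hdD, hs⟩⟩
  · obtain ⟨a', b', s', rfl⟩ := exists_joinMk_eq y
    exact hy'.1 hy.1
  · obtain ⟨a', b', s', rfl⟩ := exists_joinMk_eq y
    exact (em (b' ∈ D)).imp (fun h => ⟨h, hy.2⟩) (fun h => ⟨h, hy.2⟩)

theorem mem_suspPoles_join_of_locallyPreconnectedAt (e₁ : C₁ ≃ₜ (ℕ → Bool))
    (e₂ : C₂ ≃ₜ (ℕ → Bool)) {x : Susp (TopJoin C₁ C₂)} (hx : LocallyPreconnectedAt x) :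
    x ∈ suspPoles (TopJoin C₁ C₂) := by
  obtain ⟨y, t, rfl⟩ := exists_suspMk_eq x
  obtain ⟨a, b, s, rfl⟩ := exists_joinMk_eq y
  by_contra hpole
  have h0 : t ≠ 0 := fun ht => hpole ⟨_, t, rfl, Or.inl ht⟩
  have h1 : t ≠ 1 := fun ht => hpole ⟨_, t, rfl, Or.inr ht⟩
  by_cases hs : s = 1
  · exact not_locallyPreconnectedAt_of_ne_zero e₂ (hs ▸ one_ne_zero) h0 h1 hx
  · exact not_locallyPreconnectedAt_of_ne_one e₁ hs h0 h1 hx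

theorem compactSpace_topJoin [CompactSpace C₁] [CompactSpace C₂] :
    CompactSpace (TopJoin C₁ C₂) :=
  inferInstanceAs (CompactSpace (Quot (joinRel C₁ C₂)))

end Join

/-- If `Z` is a subspace of `ΣY` (`Y` the join of two Cantor sets) and `h : ΣZ ≃ₜ ΣY` is a
homeomorphism restricting to the inclusion on `Z` (sitting in `ΣZ` as `Z × {1/2}`), then `h`
maps the two suspension points of `ΣZ` onto the suspension points `{n, p}` of `ΣY`. -/
theorem second_suspension_same_poles (C₁ C₂ : Type u)
    [TopologicalSpace C₁] [TopologicalSpace C₂]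
    (e₁ : C₁ ≃ₜ (ℕ → Bool)) (e₂ : C₂ ≃ₜ (ℕ → Bool))
    (Z : Set (Susp (TopJoin C₁ C₂)))
    (h : Susp ↥Z ≃ₜ Susp (TopJoin C₁ C₂))
    (hrestr : ∀ z : Z, h (suspMk ↥Z z ⟨1/2, by norm_num [Set.mem_Icc]⟩) = ↑z) :
    h '' suspPoles ↥Z = suspPoles (TopJoin C₁ C₂) := by
  have : CompactSpace C₁ := e₁.symm.compactSpace
  have : CompactSpace C₂ := e₂.symm.compactSpace
  have : CompactSpace (TopJoin C₁ C₂) := compactSpace_topJoin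
  have hsymm : ∀ x ∈ suspPoles (TopJoin C₁ C₂), h.symm x ∈ suspPoles ↥Z := fun x hx =>
    mem_suspPoles_of_locallyPreconnectedAt
      (fun _ => mem_suspPoles_join_of_locallyPreconnectedAt e₁ e₂) h
      ((locallyPreconnectedAt_of_mem_suspPoles hx).map_homeomorph h.symm)
  refine Subset.antisymm ?_ fun x hx => ⟨h.symm x, hsymm x hx, h.apply_symm_apply x⟩
  rintro _ ⟨q, hq, rfl⟩
  let y : TopJoin C₁ C₂ := joinMk C₁ C₂ (e₁.symm default) (e₂.symm default) 0
  have hn : suspMk _ y 0 ∈ suspPoles (TopJoin C₁ C₂) := ⟨y, 0, rfl, Or.inl rfl⟩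
  have hp : suspMk _ y 1 ∈ suspPoles (TopJoin C₁ C₂) := ⟨y, 1, rfl, Or.inr rfl⟩
  have hne : suspHeight _ (h.symm (suspMk _ y 0)) ≠ suspHeight _ (h.symm (suspMk _ y 1)) :=
    fun heq => zero_ne_one (congrArg (suspHeight _)
      (h.symm.injective (eq_of_mem_suspPoles (hsymm _ hn) (hsymm _ hp) heq)))
  have hq' : suspHeight _ q = suspHeight _ (h.symm (suspMk _ y 0)) ∨
      suspHeight _ q = suspHeight _ (h.symm (suspMk _ y 1)) := by
    rcases suspHeight_of_mem_suspPoles hq with a | a <;>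
    rcases suspHeight_of_mem_suspPoles (hsymm _ hn) with b | b <;>
    rcases suspHeight_of_mem_suspPoles (hsymm _ hp) with c | c <;>
    simp_all
  rcases hq' with heq | heq
  · rw [eq_of_mem_suspPoles hq (hsymm _ hn) heq, h.apply_symm_apply]
    exact hn
  · rw [eq_of_mem_suspPoles hq (hsymm _ hp) heq, h.apply_symm_apply]
    exact hp
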